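/- Let δ > 0 and define τ_δ : ℝ → ℝ by τ_δ(ξ) = (ξ/δ)·tanh(δξ), and let D(ξ) denote the derivative of ξ ↦ √(τ_δ(ξ)) at ξ ≠ 0. Then for every c ∈ (0,1) there exists exactly one ξ₀ > 0 with D(ξ₀) = c; consequently, for every real number r with r ∈ (−1,0) ∪ (0,1) there exists exactly one ξ₀ ∈ ℝ \ {0} with D(ξ₀) + r = 0. -/

import Mathlib

noncomputable def auxG (y : ℝ) : ℝ :=
  (Real.sqrt (Real.sinh y / y / Real.cosh y) +
    Real.sqrt (1 / (Real.sinh y / y * Real.cosh y ^ 3))) / 2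

lemma aux_sinh_lt (y : ℝ) (hy : 0 < y) : Real.sinh y < y * Real.cosh y := by
  have h : StrictMonoOn (fun y : ℝ => y * Real.cosh y - Real.sinh y) (Set.Ici 0) := by
    apply strictMonoOn_of_deriv_pos (convex_Ici 0)
    · fun_prop
    · intro x hx
      rw [interior_Ici] at hx
      have h1 : HasDerivAt (fun y : ℝ => y * Real.cosh y - Real.sinh y)
          (1 * Real.cosh x + x * Real.sinh x - Real.cosh x) x :=
        ((hasDerivAt_id x).mul (Real.hasDerivAt_cosh x)).sub (Real.hasDerivAt_sinh x)
      rw [h1.deriv]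
      have := Real.sinh_pos_iff.2 hx
      have := mul_pos (Set.mem_Ioi.1 hx) this
      linarith
  have := h (Set.mem_Ici.2 le_rfl) (Set.mem_Ici.2 hy.le) hy
  simp at this
  linarith

lemma aux_mono1 : StrictMonoOn (fun y : ℝ => Real.sinh y / y) (Set.Ioi 0) := by
  apply strictMonoOn_of_deriv_pos (convex_Ioi 0)
  · apply ContinuousOn.div (by fun_prop) (by fun_prop)
    intro x hx
    exact (Set.mem_Ioi.1 hx).ne'
  · intro x hx
    rw [interior_Ioi] at hx
    have hx : 0 < x := hx
    have h1 : HasDerivAt (fun y : ℝ => Real.sinh y / y)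
        ((Real.cosh x * x - Real.sinh x * 1) / x ^ 2) x :=
      (Real.hasDerivAt_sinh x).div (hasDerivAt_id x) hx.ne'
    rw [h1.deriv]
    have := aux_sinh_lt x hx
    apply div_pos _ (by positivity)
    linarith

lemma aux_anti1 : StrictAntiOn (fun y : ℝ => Real.sinh y / y / Real.cosh y) (Set.Ioi 0) := by
  apply strictAntiOn_of_deriv_neg (convex_Ioi 0)
  · apply ContinuousOn.div _ (by fun_prop)
    · intro x hx
      exact (Real.cosh_pos x).ne'
    apply ContinuousOn.div (by fun_prop) (by fun_prop)
    intro x hx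
    exact (Set.mem_Ioi.1 hx).ne'
  · intro x hx
    rw [interior_Ioi] at hx
    have hx : 0 < x := hx
    have h1 : HasDerivAt (fun y : ℝ => Real.sinh y / y / Real.cosh y)
        (((Real.cosh x * x - Real.sinh x * 1) / x ^ 2 * Real.cosh x
          - Real.sinh x / x * Real.sinh x) / Real.cosh x ^ 2) x :=
      ((Real.hasDerivAt_sinh x).div (hasDerivAt_id x) hx.ne').div
        (Real.hasDerivAt_cosh x) (Real.cosh_pos x).ne'
    rw [h1.deriv]
    have hs : x < Real.sinh x := Real.self_lt_sinh_iff.2 hx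
    have hc : 1 < Real.cosh x := Real.one_lt_cosh.2 hx.ne'
    apply div_neg_of_neg_of_pos _ (by positivity)
    have e : (Real.cosh x * x - Real.sinh x * 1) / x ^ 2 * Real.cosh x
          - Real.sinh x / x * Real.sinh x
        = (x * (Real.cosh x ^ 2 - Real.sinh x ^ 2) - Real.sinh x * Real.cosh x) / x ^ 2 := by
      field_simp
      ring
    rw [e, Real.cosh_sq_sub_sinh_sq]
    apply div_neg_of_neg_of_pos _ (by positivity)
    nlinarith

lemma auxG_anti : StrictAntiOn auxG (Set.Ioi 0) := by
  intro x hx y hy hxy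
  have hx' : 0 < x := hx
  have hy' : 0 < y := hy
  have h1 := aux_anti1 hx hy hxy
  have h2 := aux_mono1 hx hy hxy
  have hsx := Real.sinh_pos_iff.2 hx'
  have hsy := Real.sinh_pos_iff.2 hy'
  have hcx := Real.cosh_pos x
  have hcy := Real.cosh_pos y
  have hc : Real.cosh x < Real.cosh y :=
    Real.cosh_strictMonoOn (Set.mem_Ici.2 hx'.le) (Set.mem_Ici.2 hy'.le) hxy
  simp only at h1 h2
  have a : Real.sqrt (Real.sinh y / y / Real.cosh y) < Real.sqrt (Real.sinh x / x / Real.cosh x) :=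
    Real.sqrt_lt_sqrt (by positivity) h1
  have b : Real.sqrt (1 / (Real.sinh y / y * Real.cosh y ^ 3)) ≤
      Real.sqrt (1 / (Real.sinh x / x * Real.cosh x ^ 3)) := by
    apply Real.sqrt_le_sqrt
    apply one_div_le_one_div_of_le (by positivity)
    gcongr
  unfold auxG
  linarith

lemma auxG_cont : ContinuousOn auxG (Set.Ioi 0) := by
  have h : ContinuousOn (fun y : ℝ => Real.sinh y / y) (Set.Ioi 0) := by
    apply ContinuousOn.div (by fun_prop) (by fun_prop)
    intro x hx
    exact (Set.mem_Ioi.1 hx).ne'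
  unfold auxG
  apply ContinuousOn.div_const
  apply ContinuousOn.add
  · apply ContinuousOn.sqrt
    apply ContinuousOn.div h (by fun_prop)
    intro x hx
    exact (Real.cosh_pos x).ne'
  · apply ContinuousOn.sqrt
    apply ContinuousOn.div (by fun_prop) (h.mul (by fun_prop))
    intro x hx
    have hx' : 0 < x := hx
    have hsx := Real.sinh_pos_iff.2 hx'
    have hcx := Real.cosh_pos x
    exact (mul_pos (div_pos hsx hx') (pow_pos hcx 3)).ne'

open Filter Topology in
lemma auxG_zero : Tendsto auxG (𝓝[>] 0) (𝓝 1) := by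
  have h : Tendsto (fun y : ℝ => Real.sinh y / y) (𝓝[>] 0) (𝓝 1) := by
    have h1 := (Real.hasDerivAt_sinh 0).tendsto_slope_zero_right
    simp only [zero_add, Real.sinh_zero, sub_zero, Real.cosh_zero, smul_eq_mul] at h1
    refine h1.congr fun y => ?_
    rw [div_eq_inv_mul]
  have hc : Tendsto Real.cosh (𝓝[>] 0) (𝓝 1) := by
    have := (Real.continuous_cosh.tendsto 0).mono_left (nhdsWithin_le_nhds (s := Set.Ioi 0))
    simpa using this
  have := (((h.div hc one_ne_zero).sqrt).add
    (((tendsto_const_nhds (x := (1:ℝ))).div (h.mul (hc.pow 3)) (by norm_num)).sqrt)).div_const 2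
  have e : ((Real.sqrt (1 / 1) + Real.sqrt (1 / (1 * 1 ^ 3))) / 2 : ℝ) = 1 := by norm_num
  rw [e] at this
  exact this

open Filter Topology in
lemma auxG_top : Tendsto auxG atTop (𝓝 0) := by
  have hi : Tendsto (fun y : ℝ => Real.sqrt (1 / y)) atTop (𝓝 0) := by
    have := (tendsto_inv_atTop_zero (𝕜 := ℝ)).sqrt
    simpa using this
  refine tendsto_of_tendsto_of_tendsto_of_le_of_le' tendsto_const_nhds hi ?_ ?_
  · refine Eventually.of_forall fun y => ?_
    unfold auxG
    positivity
  · filter_upwards [eventually_gt_atTop 0] with y hy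
    have hs : y < Real.sinh y := Real.self_lt_sinh_iff.2 hy
    have hsc : Real.sinh y < Real.cosh y := Real.sinh_lt_cosh y
    have hc : 1 < Real.cosh y := Real.one_lt_cosh.2 hy.ne'
    have a : Real.sqrt (Real.sinh y / y / Real.cosh y) ≤ Real.sqrt (1 / y) := by
      apply Real.sqrt_le_sqrt
      rw [div_div, div_le_div_iff₀ (by positivity) hy]
      nlinarith
    have b : Real.sqrt (1 / (Real.sinh y / y * Real.cosh y ^ 3)) ≤ Real.sqrt (1 / y) := by
      apply Real.sqrt_le_sqrt
      apply one_div_le_one_div_of_le hy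
      have h1 : 1 ≤ Real.sinh y / y := (one_le_div hy).2 hs.le
      have h3 : Real.cosh y ≤ Real.cosh y ^ 3 := le_self_pow₀ hc.le (by norm_num)
      nlinarith
    unfold auxG
    linarith

lemma aux_deriv (δ : ℝ) (hδ : 0 < δ) (x : ℝ) (hx : 0 < x) :
    deriv (fun x : ℝ => Real.sqrt ((x / δ) * Real.tanh (δ * x))) x = auxG (δ * x) := by
  have hy : 0 < δ * x := by positivity
  have hs := Real.sinh_pos_iff.2 hy
  have hc := Real.cosh_pos (δ * x)
  have hcs := Real.cosh_sq_sub_sinh_sq (δ * x)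
  have hlin : HasDerivAt (fun x : ℝ => δ * x) δ x := by
    simpa using (hasDerivAt_id x).const_mul δ
  have h1 : HasDerivAt (fun x : ℝ => (x / δ) * (Real.sinh (δ * x) / Real.cosh (δ * x)))
      (1 / δ * (Real.sinh (δ * x) / Real.cosh (δ * x)) + x / δ *
        ((Real.cosh (δ * x) * δ * Real.cosh (δ * x) - Real.sinh (δ * x) * (Real.sinh (δ * x) * δ))
          / Real.cosh (δ * x) ^ 2)) x :=
    ((hasDerivAt_id x).div_const δ).mul ((hlin.sinh).div (hlin.cosh) hc.ne')
  have h2 := h1.sqrt (by positivity)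
  simp only [Real.tanh_eq_sinh_div_cosh]
  rw [h2.deriv]
  unfold auxG
  have e0 : Real.cosh (δ * x) * δ * Real.cosh (δ * x) - Real.sinh (δ * x) * (Real.sinh (δ * x) * δ)
      = δ := by linear_combination δ * hcs
  rw [e0]
  generalize Real.sinh (δ * x) = s at *
  generalize Real.cosh (δ * x) = c at *
  set R := Real.sqrt (x / δ * (s / c)) with hR
  have hRp : 0 < R := Real.sqrt_pos.2 (by positivity)
  have hR2 : R ^ 2 = x / δ * (s / c) := Real.sq_sqrt (by positivity)
  have hR3 : R ^ 2 * δ * c = x * s := by rw [hR2]; field_simp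
  have a : Real.sqrt (s / (δ * x) / c) = R / x := by
    rw [Real.sqrt_eq_iff_mul_self_eq_of_pos (by positivity)]
    rw [← sq, div_pow, hR2]
    field_simp
  have b : Real.sqrt (1 / (s / (δ * x) * c ^ 3)) = x / (R * c ^ 2) := by
    rw [Real.sqrt_eq_iff_mul_self_eq_of_pos (by positivity)]
    rw [← sq, div_pow, mul_pow, hR2]
    field_simp
  rw [a, b]
  field_simp
  linear_combination (-c) * hR3

lemma aux_odd (δ x : ℝ) :
    deriv (fun x : ℝ => Real.sqrt ((x / δ) * Real.tanh (δ * x))) (-x) =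
    - deriv (fun x : ℝ => Real.sqrt ((x / δ) * Real.tanh (δ * x))) x := by
  have h := deriv_comp_neg (fun x : ℝ => Real.sqrt ((x / δ) * Real.tanh (δ * x))) x
  have e : (fun x : ℝ => Real.sqrt ((-x / δ) * Real.tanh (δ * -x))) =
      (fun x : ℝ => Real.sqrt ((x / δ) * Real.tanh (δ * x))) := by
    funext x
    rw [mul_neg, Real.tanh_neg, neg_div, neg_mul_neg]
  simp only [e] at h
  linarith

/-- For `δ > 0`, `τ_δ(ξ) = (ξ/δ)·tanh(δξ)` and `D(ξ)` the derivative of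
`ξ ↦ √(τ_δ(ξ))` at `ξ ≠ 0`: for every `c ∈ (0,1)` there is exactly one `ξ₀ > 0` with
`D(ξ₀) = c`; consequently, for every `r ∈ (−1,0) ∪ (0,1)` there is exactly one
`ξ₀ ≠ 0` with `D(ξ₀) + r = 0`. -/
theorem deriv_sqrt_tau_unique_stationary_point (δ : ℝ) (hδ : 0 < δ) :
    (∀ c ∈ Set.Ioo (0:ℝ) 1, ∃! ξ₀ : ℝ, 0 < ξ₀ ∧
      deriv (fun x : ℝ => Real.sqrt ((x / δ) * Real.tanh (δ * x))) ξ₀ = c) ∧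
    (∀ r : ℝ, r ∈ Set.Ioo (-1:ℝ) 0 ∪ Set.Ioo (0:ℝ) 1 → ∃! ξ₀ : ℝ, ξ₀ ≠ 0 ∧
      deriv (fun x : ℝ => Real.sqrt ((x / δ) * Real.tanh (δ * x))) ξ₀ + r = 0) := by
  have hD := aux_deriv δ hδ
  have hodd := aux_odd δ
  generalize deriv (fun x : ℝ => Real.sqrt ((x / δ) * Real.tanh (δ * x))) = D at hD hodd ⊢
  have hpos : ∀ x, 0 < x → 0 < D x := by
    intro x hx
    rw [hD x hx]
    have hy : 0 < δ * x := by positivity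
    have hs := Real.sinh_pos_iff.2 hy
    have hc := Real.cosh_pos (δ * x)
    unfold auxG
    positivity
  have P1 : ∀ c ∈ Set.Ioo (0:ℝ) 1, ∃! ξ₀ : ℝ, 0 < ξ₀ ∧ D ξ₀ = c := by
    intro c hc
    obtain ⟨y, hy, hyc⟩ := (isPreconnected_Ioi (a := (0:ℝ))).intermediate_value_Ioo
      (l₁ := Filter.atTop) (l₂ := nhdsWithin 0 (Set.Ioi 0))
      (Filter.le_principal_iff.2 (Filter.Ioi_mem_atTop 0))
      (Filter.le_principal_iff.2 self_mem_nhdsWithin) auxG_cont auxG_top auxG_zero hc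
    have hy : 0 < y := hy
    refine ⟨y / δ, ⟨by positivity, ?_⟩, ?_⟩
    · rw [hD _ (by positivity), mul_div_cancel₀ _ hδ.ne', hyc]
    · rintro z ⟨hz, hzc⟩
      rw [hD z hz, ← hyc] at hzc
      have := auxG_anti.injOn (Set.mem_Ioi.2 (mul_pos hδ hz)) (Set.mem_Ioi.2 hy) hzc
      rw [← this]
      field_simp
  refine ⟨P1, ?_⟩
  rintro r (hr | hr)
  · obtain ⟨x, ⟨hx, hxc⟩, hu⟩ := P1 (-r) ⟨by linarith [hr.2], by linarith [hr.1]⟩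
    refine ⟨x, ⟨hx.ne', by linarith⟩, ?_⟩
    rintro z ⟨hz, hzc⟩
    rcases lt_or_gt_of_ne hz with h | h
    · have h1 := hpos (-z) (by linarith)
      rw [hodd] at h1
      linarith [hr.2]
    · exact hu z ⟨h, by linarith⟩
  · obtain ⟨x, ⟨hx, hxc⟩, hu⟩ := P1 r hr
    refine ⟨-x, ⟨neg_ne_zero.2 (ne_of_gt hx), by rw [hodd]; linarith⟩, ?_⟩
    rintro z ⟨hz, hzc⟩
    rcases lt_or_gt_of_ne hz with h | h
    · have := hu (-z) ⟨by linarith, by rw [hodd]; linarith⟩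
      linarith
    · have h1 := hpos z h
      linarith [hr.1]
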